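/- For every t with 0 < t ≤ 1, one has scal_g(t)/6 < 1 + 8·(1/t² − 1). -/

import Mathlib

/-- For `0 < t ≤ 1`, one has `scal_g(t)/6 < 1 + 8(1/t² − 1)`. -/
theorem aloff_wallach_scal_g_lt_eigen (k l : ℤ) (hkl : k > l) (hl : 0 < l)
    (hgcd : Int.gcd k l = 1)
    (γ : ℝ) (hγ : γ = (k : ℝ) ^ 2 + (k : ℝ) * (l : ℝ) + (l : ℝ) ^ 2)
    (scal_g : ℝ → ℝ)
    (hscal : ∀ t > 0, scal_g t =
      -((10 * γ - 3 * (k : ℝ) ^ 2) * t ^ 2) / (24 * γ) +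
        (16 * γ - 3 * (k : ℝ) ^ 2) / (24 * γ * t ^ 2) + 2) :
    ∀ t : ℝ, 0 < t → t ≤ 1 → scal_g t / 6 < 1 + 8 * (1 / t ^ 2 - 1) := by
  intro t ht ht1
  rw [hscal t ht]
  have hl' : (0 : ℝ) < l := by exact_mod_cast hl
  have hk' : (0 : ℝ) < k := by exact_mod_cast hl.trans hkl
  have hkγ : (k : ℝ) ^ 2 < γ := by rw [hγ]; nlinarith [mul_pos hk' hl', pow_pos hl' 2]
  have hk2 : 0 < (k : ℝ) ^ 2 := by positivity
  have hγ0 : 0 < γ := hk2.trans hkγ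
  have hu : 1 ≤ 1 / t ^ 2 := by
    rw [le_div_iff₀ (by positivity)]
    nlinarith
  have h1 : -((10 * γ - 3 * (k : ℝ) ^ 2) * t ^ 2) / (24 * γ) ≤ 0 := by
    apply div_nonpos_of_nonpos_of_nonneg _ (by positivity)
    have : 0 ≤ (10 * γ - 3 * (k : ℝ) ^ 2) * t ^ 2 := mul_nonneg (by linarith) (by positivity)
    linarith
  have h2 : (16 * γ - 3 * (k : ℝ) ^ 2) / (24 * γ * t ^ 2) ≤ 2 / 3 * (1 / t ^ 2) := by
    have e : 2 / 3 * (1 / t ^ 2) = (16 * γ) / (24 * γ * t ^ 2) := by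
      field_simp
      norm_num
    rw [e]
    apply div_le_div_of_nonneg_right _ (by positivity)
    linarith
  linarith
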